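/- arXiv:1605.06049 — 2 statements merged into one kernel-verified Lean document; each statement's English description precedes it below -/
import Mathlib

section
/- Under the hypotheses of Theorem 3.2 (F twice continuously differentiable with λ·I ⪯ ∇²F ⪯ Λ·I and minimizer value F*; iterates w_{k+1} = w_k − α H_k g_k on a filtered probability space with μ₁·I ⪯ H_k ⪯ μ₂·I a.s., E[g_k | 𝓕_k] = ∇F(w_k), E[‖g_k‖² | 𝓕_k] ≤ γ² a.s., and α ∈ (0, 1/(2μ₁λ))), the expected optimality gaps satisfy limsup_{k→∞} (E[F(w_k)] − F*) ≤ α μ₂² γ² Λ / (4 μ₁ λ). -/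
open Matrix MeasureTheory
open scoped RealInnerProductSpace

section Deterministic

variable {E : Type*} [NormedAddCommGroup E] [InnerProductSpace ℝ E]

/-- A function on the line whose second derivative is nonnegative lies above its tangent. -/
lemma add_deriv_le_of_second_deriv_nonneg {f f' f'' : ℝ → ℝ}
    (hf : ∀ t, HasDerivAt f (f' t) t) (hf' : ∀ t, HasDerivAt f' (f'' t) t)
    (hf'' : ∀ t, 0 ≤ f'' t) : f 0 + f' 0 ≤ f 1 := by
  have hmono : Monotone f' :=
    monotone_of_deriv_nonneg (fun t => (hf' t).differentiableAt)
      (fun t => by rw [(hf' t).deriv]; exact hf'' t)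
  obtain ⟨c, hc, hslope⟩ := exists_hasDerivAt_eq_slope f f' zero_lt_one
    (fun t _ => (hf t).continuousAt.continuousWithinAt) (fun t _ => hf t)
  have := hmono hc.1.le
  rw [hslope] at this
  linarith

lemma ContDiff.gradient [CompleteSpace E] {F : E → ℝ} (hF : ContDiff ℝ 2 F) :
    ContDiff ℝ 1 (gradient F) :=
  (InnerProductSpace.toDual ℝ E).symm.contDiff.comp (hF.fderiv_right (m := 1) (by norm_num))

section Taylor

variable [CompleteSpace E] {F : E → ℝ} (hF : ContDiff ℝ 2 F)
include hF

lemma hasDerivAt_comp_line (x v : E) (t : ℝ) :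
    HasDerivAt (fun s : ℝ => F (x + s • v)) ⟪v, gradient F (x + t • v)⟫ t := by
  have hline : HasDerivAt (fun s : ℝ => x + s • v) v t := by
    simpa using ((hasDerivAt_id t).smul_const v).const_add x
  have hgrad := ((hF.differentiable (by norm_num)) (x + t • v)).hasGradientAt.hasFDerivAt
  have := hgrad.comp_hasDerivAt t hline
  rw [real_inner_comm]
  exact this

lemma hasDerivAt_inner_gradient_line (x v : E) (t : ℝ) :
    HasDerivAt (fun s : ℝ => ⟪v, gradient F (x + s • v)⟫)
      ⟪v, fderiv ℝ (gradient F) (x + t • v) v⟫ t := by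
  have hline : HasDerivAt (fun s : ℝ => x + s • v) v t := by
    simpa using ((hasDerivAt_id t).smul_const v).const_add x
  have hgrad := ((hF.gradient.differentiable (by norm_num)) (x + t • v)).hasFDerivAt
  have := (innerSL ℝ v).hasFDerivAt.comp_hasDerivAt t (hgrad.comp_hasDerivAt t hline)
  exact this

lemma quadratic_lower_bound_of_hessian {lam : ℝ}
    (hHess : ∀ u v : E, lam * ‖v‖ ^ 2 ≤ ⟪v, fderiv ℝ (gradient F) u v⟫) (x v : E) :
    F x + ⟪v, gradient F x⟫ + lam / 2 * ‖v‖ ^ 2 ≤ F (x + v) := by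
  have h := add_deriv_le_of_second_deriv_nonneg
    (f := fun t => F (x + t • v) - lam / 2 * ‖v‖ ^ 2 * t ^ 2)
    (f' := fun t => ⟪v, gradient F (x + t • v)⟫ - lam * ‖v‖ ^ 2 * t)
    (f'' := fun t => ⟪v, fderiv ℝ (gradient F) (x + t • v) v⟫ - lam * ‖v‖ ^ 2)
    (fun t => ((hasDerivAt_comp_line hF x v t).sub
      ((hasDerivAt_pow 2 t).const_mul (lam / 2 * ‖v‖ ^ 2))).congr_deriv
      (by push_cast; ring))
    (fun t => ((hasDerivAt_inner_gradient_line hF x v t).sub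
      ((hasDerivAt_id t).const_mul (lam * ‖v‖ ^ 2))).congr_deriv
      (by ring))
    (fun t => sub_nonneg.2 (hHess _ v))
  simp only [zero_smul, add_zero, one_smul] at h
  linarith

lemma quadratic_upper_bound_of_hessian {Lam : ℝ}
    (hHess : ∀ u v : E, ⟪v, fderiv ℝ (gradient F) u v⟫ ≤ Lam * ‖v‖ ^ 2) (x v : E) :
    F (x + v) ≤ F x + ⟪v, gradient F x⟫ + Lam / 2 * ‖v‖ ^ 2 := by
  have h := add_deriv_le_of_second_deriv_nonneg
    (f := fun t => Lam / 2 * ‖v‖ ^ 2 * t ^ 2 - F (x + t • v))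
    (f' := fun t => Lam * ‖v‖ ^ 2 * t - ⟪v, gradient F (x + t • v)⟫)
    (f'' := fun t => Lam * ‖v‖ ^ 2 - ⟪v, fderiv ℝ (gradient F) (x + t • v) v⟫)
    (fun t => (((hasDerivAt_pow 2 t).const_mul (Lam / 2 * ‖v‖ ^ 2)).sub
      (hasDerivAt_comp_line hF x v t)).congr_deriv
      (by push_cast; ring))
    (fun t => (((hasDerivAt_id t).const_mul (Lam * ‖v‖ ^ 2)).sub
      (hasDerivAt_inner_gradient_line hF x v t)).congr_deriv
      (by ring))
    (fun t => sub_nonneg.2 (hHess _ v))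
  simp only [zero_smul, add_zero, one_smul] at h
  linarith

/-- The Polyak–Łojasiewicz inequality for strongly convex functions. -/
lemma polyak_lojasiewicz_of_hessian {lam : ℝ} (hlam : 0 < lam)
    (hHess : ∀ u v : E, lam * ‖v‖ ^ 2 ≤ ⟪v, fderiv ℝ (gradient F) u v⟫) (x y : E) :
    2 * lam * (F x - F y) ≤ ‖gradient F x‖ ^ 2 := by
  have h := quadratic_lower_bound_of_hessian hF hHess x (y - x)
  rw [add_sub_cancel] at h
  have hsq : 0 ≤ ‖lam • (y - x) + gradient F x‖ ^ 2 := sq_nonneg _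
  rw [norm_add_sq_real, norm_smul, real_inner_smul_left, mul_pow, Real.norm_eq_abs, sq_abs] at hsq
  nlinarith [mul_le_mul_of_nonneg_left h hlam.le]

end Taylor

lemma LinearMap.IsSymmetric.norm_apply_le {T : E →ₗ[ℝ] E} (hT : T.IsSymmetric) {c : ℝ}
    (hc : 0 < c) (hpos : ∀ x, 0 ≤ ⟪T x, x⟫) (hle : ∀ x, ⟪T x, x⟫ ≤ c * ‖x‖ ^ 2) (x : E) :
    ‖T x‖ ≤ c * ‖x‖ := by
  have h1 := hpos (c • x - T x)
  have h2 := hle (T x)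
  have h3 := hle x
  have hTT : ⟪T (T x), x⟫ = ‖T x‖ ^ 2 := by rw [hT (T x) x, real_inner_self_eq_norm_sq]
  simp only [map_sub, map_smul, inner_sub_left, inner_sub_right, real_inner_smul_left,
    real_inner_smul_right, hTT, real_inner_self_eq_norm_sq] at h1
  have h4 : c * ‖T x‖ ^ 2 ≤ c * (c * (c * ‖x‖ ^ 2)) := by
    nlinarith [mul_le_mul_of_nonneg_left h3 (mul_pos hc hc).le]
  have h5 := le_of_mul_le_mul_left h4 hc
  exact le_of_sq_le_sq (by nlinarith) (by positivity)

end Deterministic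

section Matrices

variable {n : Type*} [Fintype n] [DecidableEq n] {A : Matrix n n ℝ} {a b : ℝ}

lemma Matrix.le_inner_toEuclideanLin (h : (A - a • 1).PosSemidef) (x : EuclideanSpace ℝ n) :
    a * ‖x‖ ^ 2 ≤ ⟪Matrix.toEuclideanLin A x, x⟫ := by
  have := (Matrix.isPositive_toEuclideanLin_iff.2 h).re_inner_nonneg_left x
  simp only [map_sub, map_smul, LinearMap.sub_apply, LinearMap.smul_apply, inner_sub_left,
    real_inner_smul_left, Matrix.toLpLin_one, LinearMap.id_apply, real_inner_self_eq_norm_sq,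
    RCLike.re_to_real] at this
  linarith

lemma Matrix.inner_toEuclideanLin_le (h : (b • 1 - A).PosSemidef) (x : EuclideanSpace ℝ n) :
    ⟪Matrix.toEuclideanLin A x, x⟫ ≤ b * ‖x‖ ^ 2 := by
  have := (Matrix.isPositive_toEuclideanLin_iff.2 h).re_inner_nonneg_left x
  simp only [map_sub, map_smul, LinearMap.sub_apply, LinearMap.smul_apply, inner_sub_left,
    real_inner_smul_left, Matrix.toLpLin_one, LinearMap.id_apply, real_inner_self_eq_norm_sq,
    RCLike.re_to_real] at this
  linarith

lemma Matrix.IsSymm.isSymmetric_toEuclideanLin (h : A.IsSymm) :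
    (Matrix.toEuclideanLin A).IsSymmetric := by
  rw [Matrix.isSymmetric_toEuclideanLin_iff, Matrix.IsHermitian,
    Matrix.conjTranspose_eq_transpose_of_trivial]
  exact h

lemma Matrix.norm_toEuclideanLin_le (hA : A.IsSymm) (ha : 0 ≤ a) (hb : 0 < b)
    (h : (A - a • 1).PosSemidef) (h' : (b • 1 - A).PosSemidef) (x : EuclideanSpace ℝ n) :
    ‖Matrix.toEuclideanLin A x‖ ≤ b * ‖x‖ :=
  hA.isSymmetric_toEuclideanLin.norm_apply_le hb
    (fun y => (by positivity : 0 ≤ a * ‖y‖ ^ 2).trans (Matrix.le_inner_toEuclideanLin h y))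
    (Matrix.inner_toEuclideanLin_le h') x

lemma Measurable.toEuclideanLin {Ω : Type*} {m : MeasurableSpace Ω} {H : Ω → Matrix n n ℝ}
    {g : Ω → EuclideanSpace ℝ n} (hH : ∀ i j, Measurable fun ω => H ω i j) (hg : Measurable g) :
    Measurable fun ω => Matrix.toEuclideanLin (H ω) (g ω) := by
  refine (PiLp.continuous_toLp 2 _).measurable.comp (measurable_pi_lambda _ fun i => ?_)
  change Measurable fun ω => ∑ j, H ω i j * g ω j
  have hgj : ∀ j, Measurable fun ω => g ω j := fun j =>
    (EuclideanSpace.proj (𝕜 := ℝ) j).continuous.measurable.comp hg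
  exact Finset.measurable_sum _ fun j _ => (hH i j).mul (hgj j)

end Matrices

lemma MeasureTheory.MemLp.integrable_real_inner {Ω E : Type*} [NormedAddCommGroup E]
    [InnerProductSpace ℝ E] {m0 : MeasurableSpace Ω} {μ : Measure Ω} {f g : Ω → E}
    (hf : MemLp f 2 μ) (hg : MemLp g 2 μ) : Integrable (fun ω => ⟪f ω, g ω⟫) μ :=
  (hf.norm.integrable_mul hg.norm).mono' (hf.1.inner hg.1)
    (Filter.Eventually.of_forall fun ω => norm_inner_le_norm (f ω) (g ω))

/-- Pull-out of a measurable factor from the expectation of an inner product. -/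
lemma integral_inner_eq_integral_inner_condExp {Ω E : Type*} [NormedAddCommGroup E]
    [InnerProductSpace ℝ E] [CompleteSpace E] {m m0 : MeasurableSpace Ω} {μ : Measure Ω}
    [IsFiniteMeasure μ] (hm : m ≤ m0) {Y g : Ω → E} (hY : StronglyMeasurable[m] Y)
    (hg : Integrable g μ) (hYg : Integrable (fun ω => ⟪Y ω, g ω⟫) μ) :
    ∫ ω, ⟪Y ω, g ω⟫ ∂μ = ∫ ω, ⟪Y ω, (μ[g | m]) ω⟫ ∂μ := by
  rw [← integral_condExp hm (f := fun ω => ⟪Y ω, g ω⟫)]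
  exact integral_congr_ae (condExp_bilin_of_stronglyMeasurable_left (innerSL ℝ) hY hYg hg)

/-- A nonnegative sequence contracting affinely has `limsup` at most the fixed point. -/
lemma limsup_le_of_affine_recursion {e : ℕ → ℝ} {q c : ℝ} (hq0 : 0 ≤ q) (hq1 : q < 1)
    (he : ∀ k, 0 ≤ e k) (hrec : ∀ k, e (k + 1) ≤ q * e k + (1 - q) * c) :
    Filter.limsup e Filter.atTop ≤ c := by
  have hbound : ∀ k, e k ≤ q ^ k * (e 0 - c) + c := by
    intro k
    induction k with
    | zero => simp
    | succ k ih =>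
      calc e (k + 1) ≤ q * e k + (1 - q) * c := hrec k
        _ ≤ q * (q ^ k * (e 0 - c) + c) + (1 - q) * c := by gcongr
        _ = q ^ (k + 1) * (e 0 - c) + c := by ring
  have hlim : Filter.Tendsto (fun k : ℕ => q ^ k * (e 0 - c) + c) Filter.atTop (nhds c) := by
    simpa using ((tendsto_pow_atTop_nhds_zero_of_lt_one hq0 hq1).mul_const (e 0 - c)).add_const c
  rw [← hlim.limsup_eq]
  exact Filter.limsup_le_limsup (Filter.Eventually.of_forall hbound)
    (Filter.isCoboundedUnder_le_of_le _ he) hlim.isBoundedUnder_le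

/-- asymptotic neighborhood of convergence (Theorem 3.2): limsup of the
expected optimality gap for the multi-batch L-BFGS iteration `w_{k+1} = w_k − α H_k g_k` with fixed
step length `α ∈ (0, 1/(2μ₁λ))`, eigenvalue bounds `μ₁·I ⪯ H_k ⪯ μ₂·I` a.s., unbiased
stochastic gradients `E[g_k | 𝓕_k] = ∇F(w_k)` with second moment `E[‖g_k‖² | 𝓕_k] ≤ γ²`. -/
theorem stmt_14 {d : ℕ} {Ω : Type*} {m0 : MeasurableSpace Ω} (μ : Measure Ω)
    [IsProbabilityMeasure μ] (𝓕 : Filtration ℕ m0)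
    (F : EuclideanSpace ℝ (Fin d) → ℝ) (lam Lam : ℝ)
    (hlam : 0 < lam) (hlamLam : lam ≤ Lam) (hF : ContDiff ℝ 2 F)
    (hHess : ∀ u v : EuclideanSpace ℝ (Fin d),
      lam * ‖v‖ ^ 2 ≤ ⟪v, fderiv ℝ (gradient F) u v⟫ ∧
        ⟪v, fderiv ℝ (gradient F) u v⟫ ≤ Lam * ‖v‖ ^ 2)
    (wstar : EuclideanSpace ℝ (Fin d)) (hmin : ∀ x, F wstar ≤ F x)
    (μ₁ μ₂ γ α : ℝ) (hμ₁ : 0 < μ₁) (hμ₁₂ : μ₁ ≤ μ₂) (hγ : 0 ≤ γ)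
    (hα : 0 < α) (hα2 : α < 1 / (2 * μ₁ * lam))
    (w0 : EuclideanSpace ℝ (Fin d))
    (H : ℕ → Ω → Matrix (Fin d) (Fin d) ℝ)
    (g : ℕ → Ω → EuclideanSpace ℝ (Fin d))
    (w : ℕ → Ω → EuclideanSpace ℝ (Fin d))
    (hw0 : ∀ ω, w 0 ω = w0)
    (hwrec : ∀ k ω, w (k + 1) ω = w k ω - α • Matrix.toEuclideanLin (H k ω) (g k ω))
    (hHmeas : ∀ k i j, Measurable[𝓕 k] fun ω => H k ω i j)
    (hHsymm : ∀ k, ∀ᵐ ω ∂μ, (H k ω).IsSymm)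
    (hHbound : ∀ k, ∀ᵐ ω ∂μ, (H k ω - μ₁ • 1).PosSemidef ∧
      ((μ₂ • 1 : Matrix (Fin d) (Fin d) ℝ) - H k ω).PosSemidef)
    (hgmeas : ∀ k, Measurable[𝓕 (k + 1)] (g k))
    (hgint : ∀ k, Integrable (g k) μ)
    (hg2int : ∀ k, Integrable (fun ω => ‖g k ω‖ ^ 2) μ)
    (hgcond : ∀ k, μ[g k | 𝓕 k] =ᵐ[μ] fun ω => gradient F (w k ω))
    (hg2cond : ∀ k, ∀ᵐ ω ∂μ, (μ[fun ω' => ‖g k ω'‖ ^ 2 | 𝓕 k]) ω ≤ γ ^ 2)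
    (hFint : ∀ k, Integrable (fun ω => F (w k ω)) μ)
    (hgradint : ∀ k, Integrable (fun ω => ‖gradient F (w k ω)‖ ^ 2) μ) :
    Filter.limsup (fun k => (∫ ω, F (w k ω) ∂μ) - F wstar) Filter.atTop ≤
      α * μ₂ ^ 2 * γ ^ 2 * Lam / (4 * μ₁ * lam) := by
  have hμ₂ : 0 < μ₂ := hμ₁.trans_le hμ₁₂
  have hLam : 0 < Lam := hlam.trans_le hlamLam
  have hlow := fun u v => (hHess u v).1
  have hupp := fun u v => (hHess u v).2
  have hwmeas : ∀ k, Measurable[𝓕 k] (w k) := by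
    intro k
    induction k with
    | zero =>
      rw [funext hw0]
      exact measurable_const
    | succ k ih =>
      have hle := 𝓕.mono k.le_succ
      rw [funext (hwrec k)]
      exact (ih.mono hle le_rfl).sub ((Measurable.toEuclideanLin
        (fun i j => (hHmeas k i j).mono hle le_rfl) (hgmeas k)).const_smul α)
  have hgradmeas : ∀ k, Measurable[𝓕 k] fun ω => gradient F (w k ω) := fun k =>
    hF.gradient.continuous.measurable.comp (hwmeas k)
  have hdesc : ∀ k, (∫ ω, F (w (k + 1) ω) ∂μ) ≤ (∫ ω, F (w k ω) ∂μ)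
      - α * (2 * μ₁ * lam * ((∫ ω, F (w k ω) ∂μ) - F wstar))
      + Lam / 2 * α ^ 2 * μ₂ ^ 2 * γ ^ 2 := by
    intro k
    have hle := 𝓕.le k
    set Y : Ω → EuclideanSpace ℝ (Fin d) :=
      fun ω => Matrix.toEuclideanLin (H k ω) (gradient F (w k ω)) with hYdef
    have hYmeas : Measurable[𝓕 k] Y := Measurable.toEuclideanLin (hHmeas k) (hgradmeas k)
    have hgradL2 : MemLp (fun ω => gradient F (w k ω)) 2 μ :=
      (memLp_two_iff_integrable_sq_norm
        ((hgradmeas k).mono hle le_rfl).aestronglyMeasurable).2 (hgradint k)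
    have hgL2 : MemLp (g k) 2 μ :=
      (memLp_two_iff_integrable_sq_norm (hgint k).aestronglyMeasurable).2 (hg2int k)
    have hYL2 : MemLp Y 2 μ := by
      refine hgradL2.of_le_mul (c := μ₂) (hYmeas.mono hle le_rfl).aestronglyMeasurable ?_
      filter_upwards [hHsymm k, hHbound k] with ω hs hb
      exact Matrix.norm_toEuclideanLin_le hs hμ₁.le hμ₂ hb.1 hb.2 _
    have hYg : Integrable (fun ω => ⟪Y ω, g k ω⟫) μ := hYL2.integrable_real_inner hgL2
    have hYgrad : Integrable (fun ω => ⟪Y ω, gradient F (w k ω)⟫) μ :=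
      hYL2.integrable_real_inner hgradL2
    have hinner : 2 * μ₁ * lam * ((∫ ω, F (w k ω) ∂μ) - F wstar) ≤ ∫ ω, ⟪Y ω, g k ω⟫ ∂μ := by
      rw [integral_inner_eq_integral_inner_condExp hle hYmeas.stronglyMeasurable (hgint k) hYg]
      calc 2 * μ₁ * lam * ((∫ ω, F (w k ω) ∂μ) - F wstar)
          = ∫ ω, 2 * μ₁ * lam * (F (w k ω) - F wstar) ∂μ := by
            rw [integral_const_mul, integral_sub (hFint k) (integrable_const _)]
            simp
        _ ≤ ∫ ω, ⟪Y ω, gradient F (w k ω)⟫ ∂μ := by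
            refine integral_mono_ae (((hFint k).sub (integrable_const _)).const_mul _) hYgrad ?_
            filter_upwards [hHbound k] with ω hb
            have h1 := Matrix.le_inner_toEuclideanLin hb.1 (gradient F (w k ω))
            have h2 := polyak_lojasiewicz_of_hessian hF hlam hlow (w k ω) wstar
            have h3 := mul_le_mul_of_nonneg_left h2 hμ₁.le
            change 2 * μ₁ * lam * (F (w k ω) - F wstar) ≤ _
            linarith
        _ = ∫ ω, ⟪Y ω, (μ[g k | 𝓕 k]) ω⟫ ∂μ := by
            refine integral_congr_ae ?_
            filter_upwards [hgcond k] with ω hω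
            rw [hω]
    have hsq : ∫ ω, ‖g k ω‖ ^ 2 ∂μ ≤ γ ^ 2 := by
      rw [← integral_condExp hle]
      calc ∫ ω, (μ[fun ω' => ‖g k ω'‖ ^ 2 | 𝓕 k]) ω ∂μ ≤ ∫ _, γ ^ 2 ∂μ :=
            integral_mono_ae integrable_condExp (integrable_const _) (hg2cond k)
        _ = γ ^ 2 := by simp
    have hint : Integrable (fun ω => F (w k ω) - α * ⟪Y ω, g k ω⟫) μ :=
      (hFint k).sub (hYg.const_mul α)
    have hstep : (∫ ω, F (w (k + 1) ω) ∂μ) ≤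
        ∫ ω, (F (w k ω) - α * ⟪Y ω, g k ω⟫)
          + Lam / 2 * α ^ 2 * μ₂ ^ 2 * ‖g k ω‖ ^ 2 ∂μ := by
      refine integral_mono_ae (hFint (k + 1)) (hint.add ((hg2int k).const_mul _)) ?_
      filter_upwards [hHsymm k, hHbound k] with ω hs hb
      have h1 := quadratic_upper_bound_of_hessian hF hupp (w k ω)
        (-(α • Matrix.toEuclideanLin (H k ω) (g k ω)))
      rw [← sub_eq_add_neg, ← hwrec k ω, inner_neg_left, real_inner_smul_left,
        hs.isSymmetric_toEuclideanLin, real_inner_comm, norm_neg, norm_smul, mul_pow,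
        Real.norm_eq_abs, sq_abs] at h1
      have h2 := Matrix.norm_toEuclideanLin_le hs hμ₁.le hμ₂ hb.1 hb.2 (g k ω)
      have h3 : Lam / 2 * (α ^ 2 * ‖Matrix.toEuclideanLin (H k ω) (g k ω)‖ ^ 2) ≤
          Lam / 2 * (α ^ 2 * (μ₂ * ‖g k ω‖) ^ 2) := by gcongr
      change F (w (k + 1) ω) ≤ F (w k ω) - α * ⟪Y ω, g k ω⟫
          + Lam / 2 * α ^ 2 * μ₂ ^ 2 * ‖g k ω‖ ^ 2
      simp only [hYdef]
      linarith
    rw [integral_add hint ((hg2int k).const_mul _), integral_sub (hFint k) (hYg.const_mul α),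
      integral_const_mul, integral_const_mul] at hstep
    have h1 := mul_le_mul_of_nonneg_left hinner hα.le
    have h2 := mul_le_mul_of_nonneg_left hsq
      (by positivity : 0 ≤ Lam / 2 * α ^ 2 * μ₂ ^ 2)
    linarith
  have hgap : ∀ k, 0 ≤ (∫ ω, F (w k ω) ∂μ) - F wstar := by
    intro k
    have h := integral_mono (integrable_const (F wstar)) (hFint k) fun ω => hmin (w k ω)
    rw [integral_const] at h
    simpa using h
  have hq : α * (2 * μ₁ * lam) < 1 := (lt_div_iff₀ (by positivity)).1 hα2
  have hq' : 0 < α * (2 * μ₁ * lam) := by positivity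
  refine limsup_le_of_affine_recursion (q := 1 - α * (2 * μ₁ * lam)) (by linarith) (by linarith)
    hgap fun k => ?_
  have hc : (1 - (1 - α * (2 * μ₁ * lam))) * (α * μ₂ ^ 2 * γ ^ 2 * Lam / (4 * μ₁ * lam)) =
      Lam / 2 * α ^ 2 * μ₂ ^ 2 * γ ^ 2 := by
    field_simp
    ring
  rw [hc]
  linarith [hdesc k]
end

section
/- Under the hypotheses of Theorem 3.4 (F differentiable with Λ-Lipschitz gradient bounded below by F̂; iterates w_{k+1} = w_k − α H_k g_k on a filtered probability space with μ₁·I ⪯ H_k ⪯ μ₂·I a.s., E[g_k | 𝓕_k] = ∇F(w_k), E[‖g_k‖² | 𝓕_k] ≤ γ² + η‖∇F(w_k)‖² a.s., and 0 < α ≤ μ₁/(μ₂² η Λ)), one has limsup_{L→∞} E[(1/L)·Σ_{k=0}^{L−1} ‖∇F(w_k)‖²] ≤ (α μ₂² γ² Λ)/μ₁. -/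
open Matrix MeasureTheory
open scoped RealInnerProductSpace

/-- The descent lemma: a differentiable function with `Λ`-Lipschitz gradient is bounded above by
its quadratic Taylor model. -/
theorem le_quadratic_model_of_gradient_lipschitz {E : Type*} [NormedAddCommGroup E]
    [InnerProductSpace ℝ E] [CompleteSpace E] {F : E → ℝ} {Λ : ℝ} (hdiff : Differentiable ℝ F)
    (hlip : ∀ u v : E, ‖gradient F u - gradient F v‖ ≤ Λ * ‖u - v‖) (x v : E) :
    F (x + v) ≤ F x + ⟪gradient F x, v⟫ + Λ / 2 * ‖v‖ ^ 2 := by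
  have hd : ∀ t : ℝ, HasDerivAt
      (fun t : ℝ => F (x + t • v) - t * ⟪gradient F x, v⟫ - t ^ 2 * (Λ / 2 * ‖v‖ ^ 2))
      (⟪gradient F (x + t • v), v⟫ - ⟪gradient F x, v⟫ - t * (Λ * ‖v‖ ^ 2)) t := by
    intro t
    have h1 : HasDerivAt (fun t : ℝ => x + t • v) v t := by
      simpa using ((hasDerivAt_id t).smul_const v).const_add x
    have h2 := (hdiff (x + t • v)).hasFDerivAt.comp_hasDerivAt t h1
    rw [← inner_gradient_left] at h2
    refine ((h2.sub ((hasDerivAt_id t).mul_const ⟪gradient F x, v⟫)).sub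
      ((hasDerivAt_pow 2 t).mul_const (Λ / 2 * ‖v‖ ^ 2))).congr_deriv ?_
    push_cast
    ring
  have hanti := antitoneOn_of_deriv_nonpos (convex_Icc (0 : ℝ) 1)
    (fun t _ => (hd t).continuousAt.continuousWithinAt)
    (fun t _ => (hd t).differentiableAt.differentiableWithinAt)
    (fun t ht => by
      rw [(hd t).deriv]
      rw [interior_Icc] at ht
      have h1 := real_inner_le_norm (gradient F (x + t • v) - gradient F x) v
      rw [inner_sub_left] at h1
      have h2 := hlip (x + t • v) x
      rw [add_sub_cancel_left, norm_smul, Real.norm_of_nonneg ht.1.le] at h2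
      have h3 := mul_le_mul_of_nonneg_right h2 (norm_nonneg v)
      nlinarith)
  have h := hanti (Set.left_mem_Icc.2 zero_le_one) (Set.right_mem_Icc.2 zero_le_one) zero_le_one
  simp only [one_smul, zero_smul, add_zero] at h
  linarith

/-- A symmetric operator whose quadratic form lies between `0` and `c‖x‖²` has norm at most `c`. -/
theorem LinearMap.IsSymmetric.norm_sq_apply_le {E : Type*} [NormedAddCommGroup E]
    [InnerProductSpace ℝ E] {T : E →ₗ[ℝ] E} (hT : T.IsSymmetric) {c : ℝ} (hc : 0 < c)
    (h0 : ∀ x, 0 ≤ ⟪T x, x⟫) (h1 : ∀ x, ⟪T x, x⟫ ≤ c * ‖x‖ ^ 2) (x : E) :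
    ‖T x‖ ^ 2 ≤ c ^ 2 * ‖x‖ ^ 2 := by
  have ha := h1 (c • x + T x)
  have hb := h0 (c • x - T x)
  have hx := h1 x
  have hs := hT (T x) x
  simp only [map_add, map_sub, map_smul, inner_add_left, inner_add_right, inner_sub_left,
    inner_sub_right, real_inner_smul_left, real_inner_smul_right] at ha hb
  rw [@norm_add_sq_real, norm_smul, real_inner_smul_left, Real.norm_of_nonneg hc.le,
    real_inner_comm (T x) x] at ha
  rw [real_inner_self_eq_norm_sq] at ha hb hs
  rw [hs] at ha hb
  have hx' := mul_le_mul_of_nonneg_left hx (sq_nonneg c)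
  have h4 : 0 ≤ c * (c ^ 2 * ‖x‖ ^ 2 - ‖T x‖ ^ 2) := by linarith
  have := nonneg_of_mul_nonneg_right h4 hc
  linarith

namespace Matrix

variable {n : Type*} [Fintype n] [DecidableEq n] {A : Matrix n n ℝ} {a b : ℝ}

theorem PosSemidef.inner_toEuclideanLin_ge (h : (A - a • 1).PosSemidef) (x : EuclideanSpace ℝ n) :
    a * ‖x‖ ^ 2 ≤ ⟪A.toEuclideanLin x, x⟫ := by
  have := (isPositive_toEuclideanLin_iff.2 h).re_inner_nonneg_left x
  simpa [toLpLin_one, inner_sub_left, real_inner_smul_left] using this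

theorem PosSemidef.inner_toEuclideanLin_le (h : (b • 1 - A).PosSemidef)
    (x : EuclideanSpace ℝ n) : ⟪A.toEuclideanLin x, x⟫ ≤ b * ‖x‖ ^ 2 := by
  have := (isPositive_toEuclideanLin_iff.2 h).re_inner_nonneg_left x
  simpa [toLpLin_one, inner_sub_left, real_inner_smul_left] using this

theorem norm_sq_toEuclideanLin_le (hA : A.IsSymm) (ha : 0 ≤ a) (hb : 0 < b)
    (h1 : (A - a • 1).PosSemidef) (h2 : (b • 1 - A).PosSemidef) (x : EuclideanSpace ℝ n) :
    ‖A.toEuclideanLin x‖ ^ 2 ≤ b ^ 2 * ‖x‖ ^ 2 :=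
  (isSymmetric_toEuclideanLin_iff.2 (by simpa [IsHermitian] using hA.eq)).norm_sq_apply_le hb
    (fun y => (by positivity : 0 ≤ a * ‖y‖ ^ 2).trans (h1.inner_toEuclideanLin_ge y))
    h2.inner_toEuclideanLin_le x

theorem measurable_toEuclideanLin_apply {Ω : Type*} [MeasurableSpace Ω] {M : Ω → Matrix n n ℝ}
    {v : Ω → EuclideanSpace ℝ n} (hM : ∀ i j, Measurable fun ω => M ω i j) (hv : Measurable v) :
    Measurable fun ω => (M ω).toEuclideanLin (v ω) := by
  refine (WithLp.measurable_toLp 2 (n → ℝ)).comp (measurable_pi_lambda _ fun i => ?_)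
  have hv' : ∀ j, Measurable fun ω => v ω j := fun j =>
    (measurable_pi_apply j).comp ((WithLp.measurable_ofLp 2 (n → ℝ)).comp hv)
  exact Finset.measurable_sum _ fun j _ => (hM i j).mul (hv' j)

end Matrix

theorem MeasureTheory.Integrable.inner_of_sq {E Ω : Type*} [NormedAddCommGroup E]
    [InnerProductSpace ℝ E] {m : MeasurableSpace Ω} {μ : Measure Ω} {f g : Ω → E}
    (hf : AEStronglyMeasurable f μ) (hg : AEStronglyMeasurable g μ)
    (hf2 : Integrable (fun ω => ‖f ω‖ ^ 2) μ) (hg2 : Integrable (fun ω => ‖g ω‖ ^ 2) μ) :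
    Integrable (fun ω => ⟪f ω, g ω⟫) μ := by
  refine (hf2.add hg2).mono' (hf.inner hg) (Filter.Eventually.of_forall fun ω => ?_)
  have h := norm_inner_le_norm (𝕜 := ℝ) (f ω) (g ω)
  have := two_mul_le_add_sq ‖f ω‖ ‖g ω‖
  have := mul_nonneg (norm_nonneg (f ω)) (norm_nonneg (g ω))
  simp only [Pi.add_apply]
  linarith

theorem MeasureTheory.integral_inner_condExp {E Ω : Type*} [NormedAddCommGroup E]
    [InnerProductSpace ℝ E] [CompleteSpace E] {m m0 : MeasurableSpace Ω} (hm : m ≤ m0)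
    {μ : Measure Ω} [IsFiniteMeasure μ] {f g : Ω → E} (hf : StronglyMeasurable[m] f)
    (hg : Integrable g μ) (hfg : Integrable (fun ω => ⟪f ω, g ω⟫) μ) :
    ∫ ω, ⟪f ω, (μ[g | m]) ω⟫ ∂μ = ∫ ω, ⟪f ω, g ω⟫ ∂μ := by
  rw [← integral_condExp hm (f := fun ω => ⟪f ω, g ω⟫)]
  exact integral_congr_ae
    (condExp_bilin_of_stronglyMeasurable_left (innerSL ℝ) hf hfg hg).symm

/-- If `s` is bounded below and each step decreases `s` by at least `a * G k - c`, then the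
averages of the nonnegative sequence `G` have limit superior at most `c / a`. -/
theorem limsup_average_le_of_descent {s G : ℕ → ℝ} {a c B : ℝ} (ha : 0 < a)
    (hG : ∀ k, 0 ≤ G k) (hB : ∀ k, B ≤ s k) (hstep : ∀ k, s (k + 1) ≤ s k - a * G k + c) :
    Filter.limsup (fun L : ℕ => 1 / (L : ℝ) * ∑ k ∈ Finset.range L, G k) Filter.atTop ≤ c / a := by
  have hsum : ∀ L : ℕ, a * ∑ k ∈ Finset.range L, G k ≤ s 0 - s L + L * c := by
    intro L
    induction L with
    | zero => simp
    | succ L ih =>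
      rw [Finset.sum_range_succ]
      push_cast
      linarith [hstep L]
  have hlim : Filter.Tendsto (fun L : ℕ => (s 0 - B) / a / (L : ℝ) + c / a) Filter.atTop
      (nhds (c / a)) := by
    simpa using (tendsto_const_div_atTop_nhds_zero_nat ((s 0 - B) / a)).add_const (c / a)
  rw [← hlim.limsup_eq]
  refine Filter.limsup_le_limsup ?_ (Filter.isCoboundedUnder_le_of_le _ (x := 0) fun L => ?_)
    hlim.isBoundedUnder_le
  · filter_upwards [Filter.eventually_gt_atTop 0] with L hL
    have hL' : (0 : ℝ) < L := Nat.cast_pos.2 hL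
    have h := hsum L
    have e : (s 0 - B) / a / (L : ℝ) + c / a = 1 / L * ((s 0 - B + L * c) / a) := by
      field_simp
    rw [e]
    refine mul_le_mul_of_nonneg_left ?_ (by positivity)
    rw [le_div_iff₀ ha]
    linarith [hB L]
  · exact mul_nonneg (by positivity) (Finset.sum_nonneg fun k _ => hG k)

/-- asymptotic form of Theorem 3.4 (nonconvex case): for the multi-batch
L-BFGS iteration
`w_{k+1} = w_k − α H_k g_k` with `F` bounded below by `F̂`, `∇F` `Λ`-Lipschitz,
`μ₁·I ⪯ H_k ⪯ μ₂·I` a.s., `E[g_k | 𝓕_k] = ∇F(w_k)`,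
`E[‖g_k‖² | 𝓕_k] ≤ γ² + η‖∇F(w_k)‖²` a.s., and `0 < α ≤ μ₁/(μ₂²ηΛ)`, one has for every
`limsup_{L→∞} E[(1/L)Σ_{k<L} ‖∇F(w_k)‖²] ≤ αμ₂²γ²Λ/μ₁`. -/
theorem stmt_17 {d : ℕ} {Ω : Type*} {m0 : MeasurableSpace Ω} (μ : Measure Ω)
    [IsProbabilityMeasure μ] (𝓕 : Filtration ℕ m0)
    (F : EuclideanSpace ℝ (Fin d) → ℝ) (Λ : ℝ) (hΛ : 0 < Λ)
    (hdiff : Differentiable ℝ F)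
    (hlip : ∀ u v : EuclideanSpace ℝ (Fin d),
      ‖gradient F u - gradient F v‖ ≤ Λ * ‖u - v‖)
    (Fhat : ℝ) (hbelow : ∀ x, Fhat ≤ F x)
    (μ₁ μ₂ γ η α : ℝ) (hμ₁ : 0 < μ₁) (hμ₁₂ : μ₁ ≤ μ₂) (hγ : 0 ≤ γ) (hη : 0 < η)
    (hα : 0 < α) (hα2 : α ≤ μ₁ / (μ₂ ^ 2 * η * Λ))
    (w0 : EuclideanSpace ℝ (Fin d))
    (H : ℕ → Ω → Matrix (Fin d) (Fin d) ℝ)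
    (g : ℕ → Ω → EuclideanSpace ℝ (Fin d))
    (w : ℕ → Ω → EuclideanSpace ℝ (Fin d))
    (hw0 : ∀ ω, w 0 ω = w0)
    (hwrec : ∀ k ω, w (k + 1) ω = w k ω - α • Matrix.toEuclideanLin (H k ω) (g k ω))
    (hHmeas : ∀ k i j, Measurable[𝓕 k] fun ω => H k ω i j)
    (hHsymm : ∀ k, ∀ᵐ ω ∂μ, (H k ω).IsSymm)
    (hHbound : ∀ k, ∀ᵐ ω ∂μ, (H k ω - μ₁ • 1).PosSemidef ∧
      ((μ₂ • 1 : Matrix (Fin d) (Fin d) ℝ) - H k ω).PosSemidef)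
    (hgmeas : ∀ k, Measurable[𝓕 (k + 1)] (g k))
    (hgint : ∀ k, Integrable (g k) μ)
    (hg2int : ∀ k, Integrable (fun ω => ‖g k ω‖ ^ 2) μ)
    (hgcond : ∀ k, μ[g k | 𝓕 k] =ᵐ[μ] fun ω => gradient F (w k ω))
    (hg2cond : ∀ k, ∀ᵐ ω ∂μ,
      (μ[fun ω' => ‖g k ω'‖ ^ 2 | 𝓕 k]) ω ≤ γ ^ 2 + η * ‖gradient F (w k ω)‖ ^ 2)
    (hFint : ∀ k, Integrable (fun ω => F (w k ω)) μ)
    (hgradint : ∀ k, Integrable (fun ω => ‖gradient F (w k ω)‖ ^ 2) μ) :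
    Filter.limsup
        (fun L : ℕ =>
          ∫ ω, (1 / (L : ℝ)) * ∑ k ∈ Finset.range L, ‖gradient F (w k ω)‖ ^ 2 ∂μ)
        Filter.atTop ≤
      α * μ₂ ^ 2 * γ ^ 2 * Λ / μ₁ := by
  have hμ₂ : 0 < μ₂ := hμ₁.trans_le hμ₁₂
  have hgradc : Continuous (gradient F) :=
    (LipschitzWith.of_dist_le_mul (K := ⟨Λ, hΛ.le⟩) fun u v => by
      rw [dist_eq_norm, dist_eq_norm]
      exact hlip u v).continuous
  have hwmeas : ∀ k, Measurable[𝓕 k] (w k) := by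
    intro k
    induction k with
    | zero =>
      rw [show w 0 = fun _ => w0 from funext hw0]
      exact measurable_const
    | succ k ih =>
      rw [show w (k + 1) = fun ω => w k ω - α • Matrix.toEuclideanLin (H k ω) (g k ω) from
        funext (hwrec k)]
      have hle := 𝓕.mono k.le_succ
      let _ : MeasurableSpace Ω := 𝓕 (k + 1)
      exact (ih.mono hle le_rfl).sub ((Matrix.measurable_toEuclideanLin_apply
        (fun i j => (hHmeas k i j).mono hle le_rfl) (hgmeas k)).const_smul α)
  have hgrad : ∀ k, Measurable[𝓕 k] fun ω => gradient F (w k ω) := fun k =>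
    hgradc.measurable.comp (hwmeas k)
  have hHgrad : ∀ k, Measurable[𝓕 k] fun ω => (H k ω).toEuclideanLin (gradient F (w k ω)) := by
    intro k
    let _ : MeasurableSpace Ω := 𝓕 k
    exact Matrix.measurable_toEuclideanLin_apply (hHmeas k) (hgrad k)
  have hstep : ∀ k, ∫ ω, F (w (k + 1) ω) ∂μ ≤ ∫ ω, F (w k ω) ∂μ
      - α * μ₁ / 2 * ∫ ω, ‖gradient F (w k ω)‖ ^ 2 ∂μ + Λ * α ^ 2 * μ₂ ^ 2 * γ ^ 2 / 2 := by
    intro k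
    have hHg2 : Integrable (fun ω => ‖(H k ω).toEuclideanLin (gradient F (w k ω))‖ ^ 2) μ := by
      refine ((hgradint k).const_mul (μ₂ ^ 2)).mono'
        (((hHgrad k).mono (𝓕.le k) le_rfl).norm.pow_const 2).aestronglyMeasurable ?_
      filter_upwards [hHsymm k, hHbound k] with ω hs hb
      rw [Real.norm_of_nonneg (by positivity)]
      exact Matrix.norm_sq_toEuclideanLin_le hs hμ₁.le hμ₂ hb.1 hb.2 _
    have hinner : Integrable
        (fun ω => ⟪(H k ω).toEuclideanLin (gradient F (w k ω)), g k ω⟫) μ :=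
      .inner_of_sq ((hHgrad k).mono (𝓕.le k) le_rfl).aestronglyMeasurable
        (hgint k).aestronglyMeasurable hHg2 (hg2int k)
    have hinner' : Integrable
        (fun ω => ⟪(H k ω).toEuclideanLin (gradient F (w k ω)), gradient F (w k ω)⟫) μ :=
      .inner_of_sq ((hHgrad k).mono (𝓕.le k) le_rfl).aestronglyMeasurable
        ((hgrad k).mono (𝓕.le k) le_rfl).aestronglyMeasurable hHg2 (hgradint k)
    have hlow : μ₁ * ∫ ω, ‖gradient F (w k ω)‖ ^ 2 ∂μ ≤
        ∫ ω, ⟪(H k ω).toEuclideanLin (gradient F (w k ω)), g k ω⟫ ∂μ := by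
      rw [← integral_inner_condExp (𝓕.le k) (hHgrad k).stronglyMeasurable (hgint k) hinner,
        ← integral_const_mul]
      have hcongr : (fun ω => ⟪(H k ω).toEuclideanLin (gradient F (w k ω)),
          (μ[g k | 𝓕 k]) ω⟫) =ᵐ[μ] fun ω =>
          ⟪(H k ω).toEuclideanLin (gradient F (w k ω)), gradient F (w k ω)⟫ := by
        filter_upwards [hgcond k] with ω hω
        rw [hω]
      rw [integral_congr_ae hcongr]
      refine integral_mono_ae ((hgradint k).const_mul _) hinner' ?_
      filter_upwards [hHbound k] with ω hb
      exact hb.1.inner_toEuclideanLin_ge _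
    have hvar : ∫ ω, ‖g k ω‖ ^ 2 ∂μ ≤ γ ^ 2 + η * ∫ ω, ‖gradient F (w k ω)‖ ^ 2 ∂μ := by
      rw [← integral_condExp (𝓕.le k)]
      refine (integral_mono_ae integrable_condExp
        ((integrable_const _).add ((hgradint k).const_mul η)) (hg2cond k)).trans_eq ?_
      simp only [Pi.add_apply]
      rw [integral_add (integrable_const _) ((hgradint k).const_mul η), integral_const_mul]
      simp
    have hdesc : ∫ ω, F (w (k + 1) ω) ∂μ ≤ ∫ ω, F (w k ω) ∂μ
        - α * ∫ ω, ⟪(H k ω).toEuclideanLin (gradient F (w k ω)), g k ω⟫ ∂μ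
        + Λ / 2 * (α ^ 2 * μ₂ ^ 2) * ∫ ω, ‖g k ω‖ ^ 2 ∂μ := by
      rw [← integral_const_mul, ← integral_const_mul, ← integral_sub (hFint k)
        (hinner.const_mul α), ← integral_add (by exact (hFint k).sub (hinner.const_mul α))
        ((hg2int k).const_mul _)]
      refine integral_mono_ae (hFint (k + 1)) (((hFint k).sub (hinner.const_mul α)).add
        ((hg2int k).const_mul _)) ?_
      filter_upwards [hHsymm k, hHbound k] with ω hs hb
      have h1 := le_quadratic_model_of_gradient_lipschitz hdiff hlip (w k ω)
        (-(α • (H k ω).toEuclideanLin (g k ω)))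
      rw [← sub_eq_add_neg, ← hwrec, inner_neg_right, real_inner_smul_right, norm_neg, norm_smul,
        Real.norm_of_nonneg hα.le] at h1
      have h2 : ⟪(H k ω).toEuclideanLin (gradient F (w k ω)), g k ω⟫ =
          ⟪gradient F (w k ω), (H k ω).toEuclideanLin (g k ω)⟫ :=
        Matrix.isSymmetric_toEuclideanLin_iff.2 (by simpa [IsHermitian] using hs.eq) _ _
      have h3 := mul_le_mul_of_nonneg_left
        (Matrix.norm_sq_toEuclideanLin_le hs hμ₁.le hμ₂ hb.1 hb.2 (g k ω))
        (by positivity : 0 ≤ Λ / 2 * α ^ 2)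
      rw [h2]
      nlinarith
    have hG : 0 ≤ ∫ ω, ‖gradient F (w k ω)‖ ^ 2 ∂μ := integral_nonneg fun ω => by positivity
    have hαη : α * (μ₂ ^ 2 * η * Λ) ≤ μ₁ := (le_div_iff₀ (by positivity)).1 hα2
    have h1 := mul_le_mul_of_nonneg_left hlow hα.le
    have h2 := mul_le_mul_of_nonneg_left hvar
      (by positivity : 0 ≤ Λ / 2 * (α ^ 2 * μ₂ ^ 2))
    have h3 := mul_le_mul_of_nonneg_right hαη (mul_nonneg hα.le hG)
    linarith
  have hmain := limsup_average_le_of_descent (by positivity : 0 < α * μ₁ / 2)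
    (G := fun k => ∫ ω, ‖gradient F (w k ω)‖ ^ 2 ∂μ)
    (fun k => integral_nonneg fun ω => by positivity)
    (fun k => by
      simpa using integral_mono (integrable_const Fhat) (hFint k) fun ω => hbelow (w k ω)) hstep
  simp_rw [integral_const_mul, integral_finsetSum _ fun k _ => hgradint k]
  refine hmain.trans_eq ?_
  field_simp
end
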